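/- Let A be a complete NBW over Σ that is limit deterministic with partition (Q_N, Q_D). Then there exists a limit deterministic NBW B over Σ with at most 2^{|Q|} + 2^{|Q_N|} · 3^{|F|} · 4^{|Q_D ∖ F|} states such that L(B) = Σ^ω ∖ L(A). -/

import Mathlib

open scoped Classical

/-- A nondeterministic Büchi automaton on ω-words with states `Q` over alphabet `σ`. -/
structure NBW (σ : Type) (Q : Type) where
  init : Set Q
  trans : Q → σ → Set Q
  acc : Set Q

namespace NBW

variable {σ Q : Type}

/-- `ρ` is a run of `A` on the ω-word `w`. -/
def IsRun (A : NBW σ Q) (w : ℕ → σ) (ρ : ℕ → Q) : Prop :=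
  ρ 0 ∈ A.init ∧ ∀ i, ρ (i + 1) ∈ A.trans (ρ i) (w i)

/-- `ρ` is an accepting run of `A` on `w`: it visits `A.acc` infinitely often. -/
def IsAccRun (A : NBW σ Q) (w : ℕ → σ) (ρ : ℕ → Q) : Prop :=
  A.IsRun w ρ ∧ ∀ n, ∃ m, n ≤ m ∧ ρ m ∈ A.acc

/-- The ω-language accepted by `A`. -/
def Lang (A : NBW σ Q) : Set (ℕ → σ) := {w | ∃ ρ, A.IsAccRun w ρ}

/-- `A` is complete: every state has a successor on every letter. -/
def Complete (A : NBW σ Q) : Prop := ∀ q a, (A.trans q a).Nonempty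

/-- `A` is finitely ambiguous: every accepted word has finitely many accepting runs. -/
def FinitelyAmbiguous (A : NBW σ Q) : Prop :=
  ∀ w ∈ A.Lang, {ρ | A.IsAccRun w ρ}.Finite

/-- `A` is limit deterministic with partition `(QN, QD)`. -/
def LimitDetPart (A : NBW σ Q) (QN QD : Set Q) : Prop :=
  Disjoint QN QD ∧ QN ∪ QD = Set.univ ∧ A.acc ⊆ QD ∧
    ∀ q ∈ QD, ∀ a, ∃ q' ∈ QD, A.trans q a = {q'}

/-- `A` is limit deterministic (for some partition). -/
def LimitDet (A : NBW σ Q) : Prop := ∃ QN QD, A.LimitDetPart QN QD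

end NBW

namespace NBW

/-- Transport of an automaton to `Fin m`. -/
theorem ldc_transport {σ T : Type} [Fintype T] (B : NBW σ T) (hB : B.LimitDet) :
    ∃ B' : NBW σ (Fin (Fintype.card T)), B'.LimitDet ∧ B'.Lang = B.Lang := by
  let e : T ≃ Fin (Fintype.card T) := Fintype.equivFin T
  refine ⟨⟨{x | e.symm x ∈ B.init}, fun x a => {y | e.symm y ∈ B.trans (e.symm x) a},
    {x | e.symm x ∈ B.acc}⟩, ?_, ?_⟩
  · obtain ⟨N, D, h1, h2, h3, h4⟩ := hB
    refine ⟨{x | e.symm x ∈ N}, {x | e.symm x ∈ D}, ?_, ?_, ?_, ?_⟩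
    · rw [Set.disjoint_left] at h1 ⊢
      intro x hx hx'
      exact h1 hx hx'
    · ext x
      have : e.symm x ∈ N ∪ D := by rw [h2]; trivial
      simpa using this
    · intro x hx
      exact h3 hx
    · intro x hx a
      obtain ⟨q', hq', h⟩ := h4 _ hx a
      refine ⟨e q', by simpa using hq', ?_⟩
      ext y
      simp [h, Equiv.symm_apply_eq]
  · ext w
    constructor
    · rintro ⟨ρ, ⟨h0, h1⟩, h2⟩
      exact ⟨fun i => e.symm (ρ i), ⟨h0, h1⟩, h2⟩
    · rintro ⟨ρ, ⟨h0, h1⟩, h2⟩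
      refine ⟨fun i => e (ρ i), ⟨?_, ?_⟩, ?_⟩
      · simpa using h0
      · intro i
        simpa using h1 i
      · intro n
        simpa using h2 n

section Construction

variable {σ Q : Type}

/-- Number of labels of a state: 2 on `QN`, 3 on `F`, 4 elsewhere. -/
noncomputable def ldcC (A : NBW σ Q) (QN : Set Q) (q : Q) : ℕ :=
  if q ∈ QN then 2 else if q ∈ A.acc then 3 else 4

/-- Macrostates of the deterministic part: label 0 means absent, 1 means in `N` or in `C` outside
the breakpoint set, 2 means in the breakpoint set, 3 means safe. -/
def LdcT (A : NBW σ Q) (QN : Set Q) : Type := (q : Q) → Fin (ldcC A QN q)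

noncomputable instance [Fintype Q] (A : NBW σ Q) (QN : Set Q) : Fintype (LdcT A QN) := by
  unfold LdcT; infer_instance

theorem ldcT_card [Fintype Q] (A : NBW σ Q) (QN QD : Set Q) (hld : A.LimitDetPart QN QD) :
    Fintype.card (LdcT A QN) =
      2 ^ QN.ncard * 3 ^ A.acc.ncard * 4 ^ (QD \ A.acc).ncard := by
  obtain ⟨h1, h2, h3, h4⟩ := hld
  have e : Fintype.card (LdcT A QN) = ∏ q : Q, ldcC A QN q := by
    have : Fintype.card (LdcT A QN) = Fintype.card ((q : Q) → Fin (ldcC A QN q)) :=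
      Fintype.card_congr (Equiv.refl _)
    rw [this, Fintype.card_pi]
    simp
  have e2 : ∀ q, ldcC A QN q = (if q ∈ QN then 2 else 1) * (if q ∈ A.acc then 3 else 1) *
      (if q ∈ QD \ A.acc then 4 else 1) := by
    intro q
    have hq : q ∈ QN ∨ q ∈ QD := by
      have : q ∈ QN ∪ QD := by rw [h2]; trivial
      exact this
    clear h2 e h4
    rw [Set.disjoint_left] at h1
    have := @h1 q
    have := @h3 q
    unfold ldcC
    simp only [Set.mem_sdiff]
    by_cases a : q ∈ QN <;> by_cases b : q ∈ A.acc <;> by_cases c : q ∈ QD <;> simp_all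
  have e3 : ∀ (S : Set Q) [DecidablePred (· ∈ S)] (n : ℕ), ∏ q : Q, (if q ∈ S then n else 1) = n ^ S.ncard := by
    intro S _ n
    rw [Finset.prod_ite, Finset.prod_const, Finset.prod_const_one, mul_one,
      Set.ncard_eq_toFinset_card']
    congr 2
    ext; simp
  rw [e, Finset.prod_congr rfl (fun q _ => e2 q), Finset.prod_mul_distrib,
    Finset.prod_mul_distrib, e3, e3, e3]

/-- Label of `q` after reading `a` from the labelling `t`. -/
noncomputable def ldcVal (A : NBW σ Q) (QN : Set Q) (t : LdcT A QN) (a : σ) (q : Q) : ℕ :=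
  if ∃ p, (t p : ℕ) ≠ 0 ∧ q ∈ A.trans p a then
    if q ∈ QN then 1
    else if q ∉ A.acc ∧ ∃ p, (t p : ℕ) = 3 ∧ q ∈ A.trans p a then 3
    else if (∀ p, (t p : ℕ) ≠ 2) ∨ ∃ p, (t p : ℕ) = 2 ∧ q ∈ A.trans p a then 2
    else 1
  else 0

theorem ldcVal_lt (A : NBW σ Q) (QN : Set Q) (t : LdcT A QN) (a : σ) (q : Q) :
    ldcVal A QN t a q < ldcC A QN q := by
  unfold ldcVal ldcC
  split_ifs <;> first | omega | tauto

noncomputable def ldcNext (A : NBW σ Q) (QN : Set Q) (t : LdcT A QN) (a : σ) : LdcT A QN :=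
  fun q => ⟨ldcVal A QN t a q, ldcVal_lt A QN t a q⟩

/-- Support of a macrostate. -/
def ldcSupp (A : NBW σ Q) (QN : Set Q) (t : LdcT A QN) : Set Q := {q | (t q : ℕ) ≠ 0}

/-- Subset successor. -/
def ldcPost (A : NBW σ Q) (R : Set Q) (a : σ) : Set Q := {q | ∃ p ∈ R, q ∈ A.trans p a}

theorem ldcSupp_next (A : NBW σ Q) (QN : Set Q) (t : LdcT A QN) (a : σ) :
    ldcSupp A QN (ldcNext A QN t a) = ldcPost A (ldcSupp A QN t) a := by
  ext q
  simp only [ldcSupp, ldcPost, ldcNext, ldcVal, Set.mem_ofPred_eq]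
  split_ifs <;> simp_all

/-- The complementary automaton. -/
noncomputable def ldcB (A : NBW σ Q) (QN : Set Q) : NBW σ (Set Q ⊕ LdcT A QN) where
  init := {x | match x with
    | .inl R => R = A.init
    | .inr t => ldcSupp A QN t = A.init}
  trans x a := match x with
    | .inl R => {y | match y with
      | .inl R' => R' = ldcPost A R a
      | .inr t => ldcSupp A QN t = ldcPost A R a}
    | .inr t => {.inr (ldcNext A QN t a)}
  acc := {x | match x with
    | .inl _ => False
    | .inr t => ∀ p, (t p : ℕ) ≠ 2}

theorem ldcB_limitDet (A : NBW σ Q) (QN : Set Q) : (ldcB A QN).LimitDet := by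
  refine ⟨Set.range Sum.inl, Set.range Sum.inr, ?_, ?_, ?_, ?_⟩
  · rw [Set.disjoint_left]
    rintro _ ⟨x, rfl⟩ ⟨y, hy⟩
    cases hy
  · ext x
    cases x <;> simp
  · rintro (x | x) hx
    · exact hx.elim
    · exact ⟨x, rfl⟩
  · rintro _ ⟨t, rfl⟩ a
    exact ⟨.inr (ldcNext A QN t a), ⟨_, rfl⟩, rfl⟩

theorem ldcC_QN (A : NBW σ Q) (QN : Set Q) (t : LdcT A QN) {q : Q} (h : q ∈ QN) :
    (t q : ℕ) ≤ 1 := by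
  have h1 := (t q).isLt
  have h2 : ldcC A QN q = 2 := by simp [ldcC, h]
  omega

theorem ldcC_acc (A : NBW σ Q) (QN : Set Q) (t : LdcT A QN) {q : Q} (h : q ∈ A.acc) :
    (t q : ℕ) ≠ 3 := by
  have h1 := (t q).isLt
  have h2 : ldcC A QN q ≤ 3 := by
    unfold ldcC
    rw [if_pos h]
    split_ifs <;> omega
  omega

/-- Soundness. -/
theorem ldc_sound [Fintype Q] (A : NBW σ Q) (QN QD : Set Q) (hld : A.LimitDetPart QN QD)
    (w : ℕ → σ) (hB : w ∈ (ldcB A QN).Lang) (hA : w ∈ A.Lang) : False := by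
  obtain ⟨h1, h2, h3, h4⟩ := hld
  obtain ⟨ρ, ⟨hρ0, hρ⟩, hacc⟩ := hA
  obtain ⟨β, ⟨hβ0, hβ⟩, haccB⟩ := hB
  have hnot : ∀ q ∈ QD, q ∉ QN := fun q hq hq' => (Set.disjoint_left.1 h1) hq' hq
  -- entering the second phase
  obtain ⟨k, -, hk⟩ := haccB 0
  have hex : ∃ t, β k = .inr t := by
    cases h : β k with
    | inl R => rw [h] at hk; exact hk.elim
    | inr t => exact ⟨t, rfl⟩
  obtain ⟨t0, ht0⟩ := hex
  have hinr : ∀ j, ∃ t, β (k + j) = .inr t := by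
    intro j
    induction j with
    | zero => exact ⟨t0, ht0⟩
    | succ j ih =>
      obtain ⟨t, ht⟩ := ih
      have := hβ (k + j)
      rw [ht] at this
      exact ⟨_, this⟩
  choose t ht using hinr
  have hnext : ∀ j, t (j + 1) = ldcNext A QN (t j) (w (k + j)) := by
    intro j
    have := hβ (k + j)
    rw [ht j, add_assoc, ht (j + 1)] at this
    exact Sum.inr.inj this
  -- the run stays in the support
  have hsupp : ∀ i, (match β i with
      | .inl R => ρ i ∈ R
      | .inr t => ρ i ∈ ldcSupp A QN t) := by
    intro i
    induction i with
    | zero =>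
      cases h : β 0 with
      | inl R => rw [h] at hβ0; have e : R = A.init := hβ0; simpa [e] using hρ0
      | inr t => rw [h] at hβ0; have e : ldcSupp A QN t = A.init := hβ0; simpa [e] using hρ0
    | succ i ih =>
      have hb := hβ i
      cases h : β i with
      | inl R =>
        rw [h] at hb ih
        have hp : ρ (i + 1) ∈ ldcPost A R (w i) := ⟨ρ i, ih, hρ i⟩
        cases h' : β (i + 1) with
        | inl R' =>
          rw [h'] at hb
          have e : R' = ldcPost A R (w i) := hb
          simpa [e] using hp
        | inr t =>
          rw [h'] at hb
          have e : ldcSupp A QN t = ldcPost A R (w i) := hb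
          simpa [e] using hp
      | inr t =>
        rw [h] at hb ih
        have hp : ρ (i + 1) ∈ ldcPost A (ldcSupp A QN t) (w i) := ⟨ρ i, ih, hρ i⟩
        have e : β (i + 1) = .inr (ldcNext A QN t (w i)) := hb
        rw [e]
        simpa [ldcSupp_next] using hp
  have hs : ∀ j, (t j (ρ (k + j)) : ℕ) ≠ 0 := by
    intro j
    have := hsupp (k + j)
    rw [ht j] at this
    exact this
  have hB2 : ∀ n, ∃ m, n ≤ m ∧ ∀ p, (t m p : ℕ) ≠ 2 := by
    intro n
    obtain ⟨m, hm, h⟩ := haccB (k + n)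
    obtain ⟨j, rfl⟩ : ∃ j, m = k + j := ⟨m - k, by omega⟩
    rw [ht j] at h
    exact ⟨j, by omega, h⟩
  have hF2 : ∀ n, ∃ m, n ≤ m ∧ ρ (k + m) ∈ A.acc := by
    intro n
    obtain ⟨m, hm, h⟩ := hacc (k + n)
    obtain ⟨j, rfl⟩ : ∃ j, m = k + j := ⟨m - k, by omega⟩
    exact ⟨j, by omega, h⟩
  -- the safe sets
  let S : ℕ → Set Q := fun j => {q | (t j q : ℕ) = 3}
  have hSD : ∀ j, ∀ q ∈ S j, q ∈ QD := by
    intro j q hq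
    have hq' : q ∈ QN ∪ QD := by rw [h2]; trivial
    rcases hq' with h | h
    · have := ldcC_QN A QN (t j) h
      have : (t j q : ℕ) = 3 := hq
      omega
    · exact h
  have hSsucc : ∀ j, ∀ q ∈ S (j + 1), q ∉ A.acc ∧ ∃ p ∈ S j, q ∈ A.trans p (w (k + j)) := by
    intro j q hq
    have hq : (t (j + 1) q : ℕ) = 3 := hq
    rw [hnext] at hq
    simp only [ldcNext, ldcVal] at hq
    split_ifs at hq with a b c d
    all_goals first | exact c | omega
  choose! g hgD hg using h4
  have hSimg : ∀ j, ∀ P : Set Q, (∀ p ∈ S j, g p (w (k + j)) ∉ A.acc → p ∈ P) →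
      S (j + 1) ⊆ (fun p => g p (w (k + j))) '' P := by
    intro j P hP q hq
    obtain ⟨hqa, p, hp, hpq⟩ := hSsucc j q hq
    rw [hg p (hSD j p hp)] at hpq
    have e : q = g p (w (k + j)) := hpq
    exact ⟨p, hP p hp (e ▸ hqa), e.symm⟩
  have hanti : Antitone (fun j => (S j).ncard) := by
    apply antitone_nat_of_succ_le
    intro j
    exact (Set.ncard_le_ncard (hSimg j (S j) (fun p hp _ => hp)) (Set.toFinite _)).trans
      (Set.ncard_image_le (Set.toFinite _))
  obtain ⟨n0, hn0⟩ : ∃ n0, ∀ j, n0 ≤ j → (S j).ncard = (S n0).ncard := by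
    have hne : (Set.range (fun j => (S j).ncard)).Nonempty := Set.range_nonempty _
    obtain ⟨n0, hn0⟩ := Nat.sInf_mem hne
    refine ⟨n0, fun j hj => le_antisymm (hanti hj) ?_⟩
    simp only at hn0
    rw [hn0]
    exact Nat.sInf_le ⟨j, rfl⟩
  have hSF : ∀ j, n0 ≤ j → ∀ p ∈ S j, g p (w (k + j)) ∉ A.acc := by
    intro j hj p hp hpa
    have hle := (Set.ncard_le_ncard (hSimg j (S j \ {p}) (by
      intro p' hp' hn
      refine ⟨hp', ?_⟩
      rintro rfl
      exact hn hpa)) (Set.toFinite _)).trans (Set.ncard_image_le (Set.toFinite _))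
    have hlt := Set.ncard_sdiff_singleton_lt_of_mem hp (Set.toFinite _)
    have := hn0 j hj
    have := hn0 (j + 1) (by omega)
    omega
  -- the run is eventually in QD
  obtain ⟨n1, hn1, hn1F⟩ := hF2 n0
  have hD : ∀ j, n1 ≤ j → ρ (k + j) ∈ QD := by
    intro j hj
    induction j, hj using Nat.le_induction with
    | base => exact h3 hn1F
    | succ j hj ih =>
      have := hρ (k + j)
      rw [hg _ ih] at this
      have e : ρ (k + (j + 1)) = g (ρ (k + j)) (w (k + j)) := this
      rw [e]
      exact hgD _ ih _
  have hρg : ∀ j, n1 ≤ j → ρ (k + (j + 1)) = g (ρ (k + j)) (w (k + j)) := by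
    intro j hj
    have := hρ (k + j)
    rw [hg _ (hD j hj)] at this
    exact this
  -- the run is never safe
  have hnS : ∀ j, n1 ≤ j → (t j (ρ (k + j)) : ℕ) ≠ 3 := by
    intro j hj hS
    have hstay : ∀ i, j ≤ i → ρ (k + i) ∈ S i := by
      intro i hi
      induction i, hi using Nat.le_induction with
      | base => exact hS
      | succ i hi ih =>
        have hna := hSF i (by omega) _ ih
        rw [← hρg i (by omega)] at hna
        show (t (i + 1) (ρ (k + (i + 1))) : ℕ) = 3
        rw [hnext]
        simp only [ldcNext, ldcVal]
        rw [if_pos ⟨ρ (k + i), hs i, hρ (k + i)⟩, if_neg (hnot _ (hD (i + 1) (by omega))),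
          if_pos ⟨hna, ρ (k + i), ih, hρ (k + i)⟩]
    obtain ⟨m, hm, hma⟩ := hF2 j
    exact ldcC_acc A QN (t m) hma (hstay m hm)
  -- breakpoint
  obtain ⟨m, hm, hm2⟩ := hB2 n1
  have hstay : ∀ i, m + 1 ≤ i → (t i (ρ (k + i)) : ℕ) = 2 := by
    intro i hi
    induction i, hi using Nat.le_induction with
    | base =>
      have hn3 := hnS (m + 1) (by omega)
      rw [hnext] at hn3 ⊢
      simp only [ldcNext, ldcVal] at hn3 ⊢
      rw [if_pos ⟨ρ (k + m), hs m, hρ (k + m)⟩, if_neg (hnot _ (hD (m + 1) (by omega)))] at hn3 ⊢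
      split_ifs at hn3 ⊢ with a b
      · exact absurd rfl hn3
      · rfl
      · exact absurd (Or.inl hm2) b
    | succ i hi ih =>
      have hn3 := hnS (i + 1) (by omega)
      rw [hnext] at hn3 ⊢
      simp only [ldcNext, ldcVal] at hn3 ⊢
      rw [if_pos ⟨ρ (k + i), hs i, hρ (k + i)⟩, if_neg (hnot _ (hD (i + 1) (by omega)))] at hn3 ⊢
      split_ifs at hn3 ⊢ with a b
      · exact absurd rfl hn3
      · rfl
      · exact absurd (Or.inr ⟨ρ (k + i), ih, hρ (k + i)⟩) b
  obtain ⟨m', hm', hm2'⟩ := hB2 (m + 1)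
  exact hm2' _ (hstay m' hm')

/-- Reachable sets. -/
def ldcReach (A : NBW σ Q) (w : ℕ → σ) : ℕ → Set Q
  | 0 => A.init
  | n + 1 => ldcPost A (ldcReach A w n) (w n)

theorem ldcReach_run (A : NBW σ Q) (w : ℕ → σ) (k : ℕ) : ∀ q ∈ ldcReach A w k,
    ∃ r : ℕ → Q, r 0 ∈ A.init ∧ r k = q ∧ ∀ i < k, r (i + 1) ∈ A.trans (r i) (w i) := by
  induction k with
  | zero => intro q hq; exact ⟨fun _ => q, hq, rfl, by intro i hi; omega⟩
  | succ k ih =>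
    rintro q ⟨p, hp, hq⟩
    obtain ⟨r, h0, hk, hr⟩ := ih p hp
    refine ⟨fun i => if i ≤ k then r i else q, by simpa using h0, by simp, ?_⟩
    intro i hi
    rcases Nat.lt_succ_iff_lt_or_eq.1 hi with h | rfl
    · have h1 : i ≤ k := by omega
      have h2 : i + 1 ≤ k := by omega
      simpa [h1, h2] using hr i h
    · simpa [hk] using hq

/-- A reachable path inside the deterministic part from time `k` on. -/
def LdcPath (A : NBW σ Q) (QD : Set Q) (w : ℕ → σ) (k : ℕ) (u : ℕ → Q) : Prop :=
  ∀ i, k ≤ i → u i ∈ ldcReach A w i ∧ u i ∈ QD ∧ u (i + 1) ∈ A.trans (u i) (w i)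

def LdcSafe (A : NBW σ Q) (QD : Set Q) (w : ℕ → σ) (k : ℕ) (u : ℕ → Q) : Prop :=
  LdcPath A QD w k u ∧ ∀ i, k ≤ i → u i ∉ A.acc

/-- Positions at time `j` of paths that are safe from `k` on. -/
def ldcD (A : NBW σ Q) (QD : Set Q) (w : ℕ → σ) (k j : ℕ) : Set Q :=
  {q | ∃ u, LdcSafe A QD w k u ∧ u j = q}

theorem ldcD_mono (A : NBW σ Q) (QD : Set Q) (w : ℕ → σ) {k k' : ℕ} (h : k ≤ k') (j : ℕ) :
    ldcD A QD w k j ⊆ ldcD A QD w k' j := by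
  rintro q ⟨u, ⟨h1, h2⟩, h3⟩
  exact ⟨u, ⟨fun i hi => h1 i (h.trans hi), fun i hi => h2 i (h.trans hi)⟩, h3⟩

theorem ldcPath_safe (A : NBW σ Q) (QD : Set Q) (w : ℕ → σ) (hw : w ∉ A.Lang) {k : ℕ} {u : ℕ → Q}
    (h : LdcPath A QD w k u) : ∃ k', k ≤ k' ∧ LdcSafe A QD w k' u := by
  obtain ⟨r, h0, hk, hr⟩ := ldcReach_run A w k (u k) (h k le_rfl).1
  by_contra hcon
  apply hw
  refine ⟨fun i => if i < k then r i else u i, ⟨?_, ?_⟩, ?_⟩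
  · by_cases hk0 : 0 < k
    · simpa [hk0] using h0
    · have : k = 0 := by omega
      subst this
      simpa [← hk] using h0
  · intro i
    by_cases h1 : i + 1 < k
    · have h2 : i < k := by omega
      simpa [h1, h2] using hr i h2
    · by_cases h2 : i < k
      · have h3 : i + 1 = k := by omega
        have := hr i h2
        rw [h3, hk] at this
        simpa [h2, h3] using this
      · simpa [h1, h2] using (h i (by omega)).2.2
  · intro n
    by_contra hn
    push Not at hn
    apply hcon
    refine ⟨max k n, le_max_left _ _, fun i hi => h i ((le_max_left _ _).trans hi), ?_⟩
    intro i hi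
    have := hn i ((le_max_right _ _).trans hi)
    have h2 : ¬ i < k := by have := (le_max_left k n).trans hi; omega
    simpa [h2] using this

theorem ldcPath_exists (A : NBW σ Q) (QN QD : Set Q) (hld : A.LimitDetPart QN QD) (w : ℕ → σ)
    {k : ℕ} {q : Q} (hq : q ∈ ldcReach A w k) (hqD : q ∈ QD) :
    ∃ u, LdcPath A QD w k u ∧ u k = q := by
  obtain ⟨h1, h2, h3, h4⟩ := hld
  choose! g hgD hg using h4
  let v : ℕ → Q := fun n => Nat.rec q (fun n p => g p (w (k + n))) n
  have hv : ∀ n, v n ∈ ldcReach A w (k + n) ∧ v n ∈ QD := by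
    intro n
    induction n with
    | zero => exact ⟨hq, hqD⟩
    | succ n ih =>
      refine ⟨⟨v n, ih.1, ?_⟩, hgD _ ih.2 _⟩
      rw [hg _ ih.2]
      rfl
  refine ⟨fun i => v (i - k), ?_, by simp [v]⟩
  intro i hi
  obtain ⟨n, rfl⟩ : ∃ n, i = k + n := ⟨i - k, by omega⟩
  have e1 : k + n - k = n := by omega
  have e2 : k + n + 1 - k = n + 1 := by omega
  simp only [e1, e2]
  refine ⟨(hv n).1, (hv n).2, ?_⟩
  rw [hg _ (hv n).2]
  rfl

theorem ldc_merge [Fintype Q] (A : NBW σ Q) (QD : Set Q) (w : ℕ → σ) (hw : w ∉ A.Lang) :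
    ∃ k, ∀ i, k ≤ i → ∀ u, LdcPath A QD w i u → ∃ j, i ≤ j ∧ u j ∈ ldcD A QD w k j := by
  let P : ℕ → Prop := fun m => ∃ k, ∀ j, k ≤ j → m ≤ (ldcD A QD w k j).ncard
  have hP0 : P 0 := ⟨0, fun _ _ => Nat.zero_le _⟩
  have hb : ∀ m, P m → m ≤ Fintype.card Q := by
    rintro m ⟨k, hk⟩
    refine (hk k le_rfl).trans ?_
    rw [← Nat.card_eq_fintype_card, ← Set.ncard_univ]
    exact Set.ncard_le_ncard (Set.subset_univ _) (Set.toFinite _)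
  obtain ⟨k, hk⟩ : P (Nat.findGreatest P (Fintype.card Q)) :=
    Nat.findGreatest_spec (Nat.zero_le _) hP0
  refine ⟨k, fun i hi u hu => ?_⟩
  by_contra hcon
  push Not at hcon
  obtain ⟨i', hi', hs⟩ := ldcPath_safe A QD w hw hu
  have hP : P (Nat.findGreatest P (Fintype.card Q) + 1) := by
    refine ⟨i', fun j hj => ?_⟩
    have hsub : insert (u j) (ldcD A QD w k j) ⊆ ldcD A QD w i' j := by
      intro q hq
      rcases hq with rfl | hq
      · exact ⟨u, hs, rfl⟩
      · exact ldcD_mono A QD w (hi.trans hi') j hq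
    have := Set.ncard_le_ncard hsub (Set.toFinite _)
    rw [Set.ncard_insert_of_notMem (hcon j (hi'.trans hj)) (Set.toFinite _)] at this
    have := hk j (by omega)
    omega
  have := Nat.le_findGreatest (hb _ hP) hP
  omega

/-- Completeness. -/
theorem ldc_complete [Fintype Q] (A : NBW σ Q) (QN QD : Set Q) (hld : A.LimitDetPart QN QD)
    (w : ℕ → σ) (hw : w ∉ A.Lang) : w ∈ (ldcB A QN).Lang := by
  obtain ⟨k, hk⟩ := ldc_merge A QD w hw
  have hld' := hld
  obtain ⟨h1, h2, h3, h4⟩ := hld'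
  have hnot : ∀ q ∈ QD, q ∉ QN := fun q hq hq' => (Set.disjoint_left.1 h1) hq' hq
  have hDD : ∀ j, k ≤ j → ∀ q ∈ ldcD A QD w k j,
      q ∈ ldcReach A w j ∧ q ∉ QN ∧ q ∉ A.acc := by
    rintro j hj q ⟨u, ⟨hu, hu'⟩, rfl⟩
    exact ⟨(hu j hj).1, hnot _ (hu j hj).2.1, hu' j hj⟩
  -- starting macrostate
  have hlt : ∀ q, (if q ∈ ldcD A QD w k k then 3 else if q ∈ ldcReach A w k then 1 else 0)
      < ldcC A QN q := by
    intro q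
    have := hDD k le_rfl q
    unfold ldcC
    split_ifs <;> first | omega | tauto
  let t0 : LdcT A QN := fun q => ⟨_, hlt q⟩
  obtain ⟨t, ht0, ht⟩ : ∃ t : ℕ → LdcT A QN, t 0 = t0 ∧
      ∀ n, t (n + 1) = ldcNext A QN (t n) (w (k + n)) :=
    ⟨fun n => Nat.rec t0 (fun n s => ldcNext A QN s (w (k + n))) n, rfl, fun n => rfl⟩
  have hsupp : ∀ n, ldcSupp A QN (t n) = ldcReach A w (k + n) := by
    intro n
    induction n with
    | zero =>
      ext q
      have := hDD k le_rfl q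
      simp only [ht0, t0, ldcSupp, Set.mem_ofPred_eq, add_zero]
      split_ifs <;> simp_all
    | succ n ih =>
      rw [ht, ldcSupp_next, ih]
      rfl
  have hDS : ∀ n, ∀ q ∈ ldcD A QD w k (k + n), (t n q : ℕ) = 3 := by
    intro n
    induction n with
    | zero =>
      intro q hq
      simp only [add_zero] at hq
      simp [ht0, t0, hq]
    | succ n ih =>
      intro q hq
      obtain ⟨hq1, hq2, hq3⟩ := hDD (k + (n + 1)) (by omega) q hq
      obtain ⟨u, hu, rfl⟩ := hq
      have hp : (t n (u (k + n)) : ℕ) = 3 := ih _ ⟨u, hu, rfl⟩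
      have htr := (hu.1 (k + n) (by omega)).2.2
      rw [ht]
      simp only [ldcNext, ldcVal]
      rw [if_pos ⟨u (k + n), by omega, htr⟩, if_neg hq2, if_pos ⟨hq3, u (k + n), hp, htr⟩]
  have hbreak : ∀ n, ∃ m, n ≤ m ∧ ∀ p, (t m p : ℕ) ≠ 2 := by
    intro n
    by_contra hcon
    push Not at hcon
    have hpath : ∀ q, (t n q : ℕ) = 2 → ∃ u, LdcPath A QD w (k + n) u ∧ u (k + n) = q := by
      intro q hq
      apply ldcPath_exists A QN QD hld w
      · rw [← hsupp]
        show (t n q : ℕ) ≠ 0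
        omega
      · have hq' : q ∈ QN ∪ QD := by rw [h2]; trivial
        rcases hq' with h | h
        · have := ldcC_QN A QN (t n) h
          omega
        · exact h
    choose! u hu huq using hpath
    have hm : ∀ q, ∃ j, (t n q : ℕ) = 2 → (k + n ≤ j ∧ u q j ∈ ldcD A QD w k j) := by
      intro q
      by_cases hq : (t n q : ℕ) = 2
      · obtain ⟨j, hj⟩ := hk (k + n) (by omega) (u q) (hu q hq)
        exact ⟨j, fun _ => hj⟩
      · exact ⟨0, fun h => absurd h hq⟩
    choose f hf using hm
    have htrack : ∀ j, n ≤ j → ∀ q, (t j q : ℕ) = 2 →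
        ∃ p, (t n p : ℕ) = 2 ∧ u p (k + j) = q := by
      intro j hj
      induction j, hj using Nat.le_induction with
      | base => intro q hq; exact ⟨q, hq, huq q hq⟩
      | succ j hj ih =>
        intro q hq
        rw [ht] at hq
        simp only [ldcNext, ldcVal] at hq
        have d : (∀ p, (t j p : ℕ) ≠ 2) ∨ ∃ p, (t j p : ℕ) = 2 ∧ q ∈ A.trans p (w (k + j)) := by
          by_contra d
          rw [if_neg d] at hq
          split_ifs at hq <;> omega
        rcases d with d | ⟨p, hp, hpq⟩
        · obtain ⟨p, hp⟩ := hcon j hj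
          exact absurd hp (d p)
        · obtain ⟨p', hp', rfl⟩ := ih p hp
          refine ⟨p', hp', ?_⟩
          obtain ⟨_, hD, htr⟩ := hu p' hp' (k + j) (by omega)
          obtain ⟨q', _, e⟩ := h4 _ hD (w (k + j))
          rw [e] at htr hpq
          have e1 : u p' (k + j + 1) = q' := htr
          have e2 : q = q' := hpq
          rw [e2, ← e1]
          rfl
    -- stability of merging
    have hstab : ∀ q, (t n q : ℕ) = 2 → ∀ j, f q ≤ j → u q j ∈ ldcD A QD w k j := by
      intro q hq j hj
      have hfq := hf q hq
      induction j, hj using Nat.le_induction with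
      | base => exact hfq.2
      | succ j hj ih =>
        obtain ⟨v, hv, hvj⟩ := ih
        refine ⟨v, hv, ?_⟩
        have ha := (hv.1 j (by omega)).2.2
        obtain ⟨_, hD, hb⟩ := hu q hq j (by omega)
        rw [hvj] at ha
        obtain ⟨q', _, e⟩ := h4 _ hD (w j)
        rw [e] at ha hb
        have e1 : v (j + 1) = q' := ha
        have e2 : u q (j + 1) = q' := hb
        rw [e1, e2]
    let M := n + ∑ q, f q
    obtain ⟨q, hq⟩ := hcon M (by omega)
    obtain ⟨p, hp, hpq⟩ := htrack M (by omega) q hq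
    have hle : f p ≤ ∑ q, f q := Finset.single_le_sum (fun _ _ => Nat.zero_le _) (Finset.mem_univ p)
    have h3' := hDS M q (hpq ▸ hstab p hp (k + M) (by omega))
    omega
  refine ⟨fun i => if i < k then .inl (ldcReach A w i) else .inr (t (i - k)), ⟨?_, ?_⟩, ?_⟩
  · by_cases h : 0 < k
    · simp only [h, if_true]
      exact (rfl : ldcReach A w 0 = A.init)
    · have : k = 0 := by omega
      simp only [h, if_false]
      show ldcSupp A QN (t (0 - k)) = A.init
      rw [hsupp]
      subst this
      rfl
  · intro i
    dsimp only
    by_cases h : i + 1 < k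
    · have h' : i < k := by omega
      rw [if_pos h, if_pos h']
      exact (rfl : ldcReach A w (i + 1) = ldcPost A (ldcReach A w i) (w i))
    · by_cases h' : i < k
      · rw [if_neg h, if_pos h']
        show ldcSupp A QN (t (i + 1 - k)) = ldcReach A w (i + 1)
        rw [hsupp]
        congr 1
        omega
      · rw [if_neg h, if_neg h']
        obtain ⟨n, rfl⟩ : ∃ n, i = k + n := ⟨i - k, by omega⟩
        have e1 : k + n - k = n := by omega
        have e2 : k + n + 1 - k = n + 1 := by omega
        rw [e1, e2]
        show Sum.inr (t (n + 1)) = (Sum.inr (ldcNext A QN (t n) (w (k + n))) : Set Q ⊕ _)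
        rw [ht]
  · intro n
    obtain ⟨m, hm, h⟩ := hbreak n
    refine ⟨k + m, by omega, ?_⟩
    have h' : ¬ k + m < k := by omega
    have e1 : k + m - k = m := by omega
    simp only [h', if_false, e1]
    exact h

end Construction

end NBW

/-- Every complete limit deterministic NBW with partition `(QN, QD)` has a limit
deterministic complementary NBW with at most
`2 ^ |Q| + 2 ^ |QN| * 3 ^ |F| * 4 ^ |QD \ F|` states. -/
theorem NBW.ldbw_complement (σ Q : Type) [Fintype σ] [Nonempty σ] [Fintype Q]
    (A : NBW σ Q) (QN QD : Set Q)
    (hc : A.Complete) (hld : A.LimitDetPart QN QD) :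
    ∃ (m : ℕ) (B : NBW σ (Fin m)), B.LimitDet ∧
      m ≤ 2 ^ Fintype.card Q + 2 ^ QN.ncard * 3 ^ A.acc.ncard * 4 ^ (QD \ A.acc).ncard ∧
      B.Lang = Set.univ \ A.Lang := by
  obtain ⟨B, hB, hL⟩ := NBW.ldc_transport (NBW.ldcB A QN) (NBW.ldcB_limitDet A QN)
  refine ⟨_, B, hB, ?_, ?_⟩
  · rw [Fintype.card_sum, Fintype.card_set, NBW.ldcT_card A QN QD hld]
  · rw [hL]
    ext w
    constructor
    · intro h
      exact ⟨trivial, fun h' => NBW.ldc_sound A QN QD hld w h h'⟩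
    · rintro ⟨-, h⟩
      exact NBW.ldc_complete A QN QD hld w h
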